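/- Let Q be a primitive, indefinite integral binary quadratic form whose discriminant D = D_Q is not a perfect square. Let (t_Q, u_Q) be the fundamental solution of the Pell equation t² − D u² = 4 (t_Q, u_Q > 0, u_Q minimal), ε_Q = (t_Q + u_Q√D)/2 and R_Q = log ε_Q. Let Ψ_Q(t) be the number of orbits of SO(Q,ℤ) on the set of pairs (x,y) of coprime integers with |Q(x,y)| ≤ t. Then Ψ_Q(t) ∼ (12 R_Q / (π² √D)) · t as t → +∞. -/

import Mathlib

open scoped Real

abbrev SL2Z := Matrix.SpecialLinearGroup (Fin 2) ℤ

/-- The value `Q(x, y) = A x² + B x y + C y²` of the integral binary quadratic form with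
coefficients `(A, B, C)` on the pair `x = (x₁, x₂)`. -/
def Qval (A B C : ℤ) (x : ℤ × ℤ) : ℤ := A * x.1 ^ 2 + B * x.1 * x.2 + C * x.2 ^ 2

/-- The linear action of `SL(2,ℤ)` on `ℤ²`. -/
def actPair (g : SL2Z) (x : ℤ × ℤ) : ℤ × ℤ :=
  (g.1 0 0 * x.1 + g.1 0 1 * x.2, g.1 1 0 * x.1 + g.1 1 1 * x.2)

/-- The right action of `SL(2,ℤ)` on binary quadratic forms,
`(Q ∘ γ)(X, Y) = Q(aX + bY, cX + dY)`, on the coefficients `(A, B, C)`; the automorph group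
`SO(Q, ℤ)` is the set of `γ ∈ SL₂(ℤ)` with `Q ∘ γ = Q`. -/
def formComp (A B C : ℤ) (g : SL2Z) : ℤ × ℤ × ℤ :=
  (A * (g.1 0 0) ^ 2 + B * (g.1 0 0) * (g.1 1 0) + C * (g.1 1 0) ^ 2,
   2 * A * (g.1 0 0) * (g.1 0 1) + B * ((g.1 0 0) * (g.1 1 1) + (g.1 0 1) * (g.1 1 0))
     + 2 * C * (g.1 1 0) * (g.1 1 1),
   A * (g.1 0 1) ^ 2 + B * (g.1 0 1) * (g.1 1 1) + C * (g.1 1 1) ^ 2)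

/-- `Ψ_Q(t)`: the number of orbits of `SO(Q,ℤ)` on the set of pairs of coprime integers
`(x, y)` with `|Q(x, y)| ≤ t`. -/
noncomputable def Psi (A B C : ℤ) (t : ℝ) : ℕ :=
  Nat.card (Quot (fun x y :
      {x : ℤ × ℤ // IsCoprime x.1 x.2 ∧ ((|Qval A B C x| : ℤ) : ℝ) ≤ t} =>
    ∃ g : SL2Z, formComp A B C g = (A, B, C) ∧ (y : ℤ × ℤ) = actPair g (x : ℤ × ℤ)))

/-- The number of primitive points is obtained from the number of all points by Möbius inversion. -/
theorem ncard_isCoprime_eq_tsum_moebius {X : Set (ℤ × ℤ)} {f : ℤ × ℤ → ℝ}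
    (hX : ∀ (x : ℤ × ℤ) (d : ℕ), 0 < d → ((d : ℤ) • x ∈ X ↔ x ∈ X))
    (hf : ∀ (x : ℤ × ℤ) (d : ℕ), f ((d : ℤ) • x) = (d : ℝ) ^ 2 * f x)
    (h0 : (0 : ℤ × ℤ) ∉ X) (t : ℝ) (hfin : {x | x ∈ X ∧ f x ≤ t}.Finite) :
    (({x | IsCoprime x.1 x.2 ∧ x ∈ X ∧ f x ≤ t}.ncard : ℕ) : ℝ) =
      ∑' d : ℕ, (ArithmeticFunction.moebius d : ℝ) *
        (({x | x ∈ X ∧ f x ≤ t / (d : ℝ) ^ 2}.ncard : ℕ) : ℝ) := by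
  classical
  set S := hfin.toFinset with hS
  let gc : ℤ × ℤ → ℕ := fun x => Int.gcd x.1 x.2
  have hgpos : ∀ x ∈ S, gc x ≠ 0 := by
    intro x hx h
    obtain ⟨h1, h2⟩ := Int.gcd_eq_zero_iff.1 h
    have : x = 0 := Prod.ext h1 h2
    subst this
    simp [hS, h0] at hx
  have hcard : ∀ d : ℕ, 0 < d → {x | x ∈ X ∧ f x ≤ t / (d : ℝ) ^ 2}.ncard =
      (S.filter (fun x => d ∣ gc x)).card := by
    intro d hd
    have hd' : (0 : ℝ) < (d : ℝ) ^ 2 := by positivity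
    have hdz : (d : ℤ) ≠ 0 := by exact_mod_cast hd.ne'
    rw [← Set.ncard_coe_finset]
    refine Set.ncard_congr (fun x _ => (d : ℤ) • x) ?_ ?_ ?_
    · rintro x ⟨hx1, hx2⟩
      simp only [Finset.coe_filter, hS, Set.Finite.mem_toFinset, Set.mem_ofPred_eq]
      refine ⟨⟨(hX x d hd).2 hx1, ?_⟩, ?_⟩
      · rw [hf]; rw [le_div_iff₀ hd'] at hx2; linarith
      · simp only [gc, Prod.smul_fst, Prod.smul_snd, smul_eq_mul]
        rw [Int.gcd_mul_left]
        simp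
    · intro x y _ _ hxy
      exact smul_right_injective _ hdz hxy
    · intro y hy
      simp only [Finset.coe_filter, hS, Set.Finite.mem_toFinset, Set.mem_ofPred_eq] at hy
      obtain ⟨⟨hy1, hy2⟩, hy3⟩ := hy
      obtain ⟨a, ha⟩ : (d : ℤ) ∣ y.1 := (Int.natCast_dvd_natCast.2 hy3).trans (Int.gcd_dvd_left _ _)
      obtain ⟨b, hb⟩ : (d : ℤ) ∣ y.2 := (Int.natCast_dvd_natCast.2 hy3).trans (Int.gcd_dvd_right _ _)
      have hyy : y = (d : ℤ) • (a, b) := Prod.ext ha hb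
      rw [hyy, hX _ _ hd] at hy1
      rw [hyy, hf] at hy2
      refine ⟨(a, b), ⟨hy1, ?_⟩, hyy.symm⟩
      rw [le_div_iff₀ hd']; linarith
  set K := S.sup gc + 1 with hK
  have hKlt : ∀ x ∈ S, gc x < K := fun x hx => Nat.lt_succ_of_le (Finset.le_sup hx)
  rw [tsum_eq_sum (s := Finset.range K)]
  · have h1 : {x | IsCoprime x.1 x.2 ∧ x ∈ X ∧ f x ≤ t} =
        ((S.filter (fun x => IsCoprime x.1 x.2) : Finset (ℤ × ℤ)) : Set (ℤ × ℤ)) := by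
      ext x; simp [hS, and_comm]
    rw [h1, Set.ncard_coe_finset, Finset.card_filter, Nat.cast_sum]
    have h2 : ∀ x ∈ S, (((if IsCoprime x.1 x.2 then 1 else 0 : ℕ)) : ℝ) =
        ∑ d ∈ Finset.range K, if d ∣ gc x then (ArithmeticFunction.moebius d : ℝ) else 0 := by
      intro x hx
      rw [← Finset.sum_filter]
      have h3 : (Finset.range K).filter (fun d => d ∣ gc x) = (gc x).divisors := by
        ext d
        simp only [Finset.mem_filter, Finset.mem_range, Nat.mem_divisors]
        exact ⟨fun h => ⟨h.2, hgpos x hx⟩, fun h =>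
          ⟨(Nat.le_of_dvd (Nat.pos_of_ne_zero h.2) h.1).trans_lt (hKlt x hx), h.1⟩⟩
      rw [h3]
      have h4 : ((ArithmeticFunction.moebius : ArithmeticFunction ℝ) *
          (ArithmeticFunction.zeta : ArithmeticFunction ℝ)) (gc x) =
          (1 : ArithmeticFunction ℝ) (gc x) := by
        rw [ArithmeticFunction.coe_moebius_mul_coe_zeta]
      rw [ArithmeticFunction.coe_mul_zeta_apply, ArithmeticFunction.one_apply] at h4
      simp only [ArithmeticFunction.intCoe_apply] at h4
      rw [h4]
      simp only [Int.isCoprime_iff_gcd_eq_one, gc]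
      push_cast
      rfl
    rw [Finset.sum_congr rfl h2, Finset.sum_comm]
    refine Finset.sum_congr rfl fun d _ => ?_
    rcases Nat.eq_zero_or_pos d with rfl | hd
    · simp
    · rw [hcard d hd, ← Finset.sum_filter, Finset.sum_const, nsmul_eq_mul, mul_comm]
  · intro d hd
    rcases Nat.eq_zero_or_pos d with rfl | hd0
    · simp
    · rw [hcard d hd0, Finset.filter_eq_empty_iff.2]
      · simp
      · intro x hx h
        exact hd (Finset.mem_range.2
          ((Nat.le_of_dvd (Nat.pos_of_ne_zero (hgpos x hx)) h).trans_lt (hKlt x hx)))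

theorem tsum_moebius_div_sq :
    ∑' d : ℕ, (ArithmeticFunction.moebius d : ℝ) / (d : ℝ) ^ 2 = 6 / π ^ 2 := by
  have h := ArithmeticFunction.LSeries_zeta_mul_Lseries_moebius (s := 2) (by norm_num)
  rw [ArithmeticFunction.LSeries_zeta_eq_riemannZeta (by norm_num), riemannZeta_two] at h
  have h2 : LSeries (fun n => (ArithmeticFunction.moebius n : ℂ)) 2 =
      ((∑' d : ℕ, (ArithmeticFunction.moebius d : ℝ) / (d : ℝ) ^ 2 : ℝ) : ℂ) := by
    rw [LSeries, Complex.ofReal_tsum]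
    refine tsum_congr fun n => ?_
    rcases eq_or_ne n 0 with rfl | hn
    · simp
    · rw [LSeries.term_of_ne_zero hn]
      norm_cast
  rw [h2] at h
  have hpi : (π : ℝ) ≠ 0 := Real.pi_ne_zero
  have h3 : π ^ 2 / 6 * ∑' d : ℕ, (ArithmeticFunction.moebius d : ℝ) / (d : ℝ) ^ 2 = 1 := by
    exact_mod_cast h
  field_simp at h3 ⊢
  linarith

open Filter Topology in
/-- If the counting function of a homogeneous quadratic function on a cone of integral points is
asymptotically linear, then so is that of the primitive points, with slope multiplied by
`6 / π ^ 2`. -/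
theorem tendsto_ncard_isCoprime_div {X : Set (ℤ × ℤ)} {f : ℤ × ℤ → ℝ} {c : ℝ}
    (hX : ∀ (x : ℤ × ℤ) (d : ℕ), 0 < d → ((d : ℤ) • x ∈ X ↔ x ∈ X))
    (hf : ∀ (x : ℤ × ℤ) (d : ℕ), f ((d : ℤ) • x) = (d : ℝ) ^ 2 * f x)
    (hf1 : ∀ x ∈ X, 1 ≤ f x) (h0 : (0 : ℤ × ℤ) ∉ X) (hc : 0 < c)
    (hN : Tendsto (fun t : ℝ => (({x | x ∈ X ∧ f x ≤ t}.ncard : ℕ) : ℝ) / t) atTop (𝓝 c)) :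
    Tendsto (fun t : ℝ => (({x | IsCoprime x.1 x.2 ∧ x ∈ X ∧ f x ≤ t}.ncard : ℕ) : ℝ) / t) atTop
      (𝓝 (6 / π ^ 2 * c)) := by
  set N : ℝ → ℝ := fun t => (({x | x ∈ X ∧ f x ≤ t}.ncard : ℕ) : ℝ) with hNdef
  have hNnn : ∀ t, 0 ≤ N t := fun t => Nat.cast_nonneg _
  have hfin : ∀ t : ℝ, {x | x ∈ X ∧ f x ≤ t}.Finite := by
    intro t
    obtain ⟨s, hs1, hs2⟩ := ((hN.eventually_const_lt hc).and (eventually_ge_atTop t)).exists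
    have h : {x | x ∈ X ∧ f x ≤ s}.Finite := by
      by_contra h
      simp only [Set.Infinite.ncard h] at hs1
      simp at hs1
    exact h.subset fun x hx => ⟨hx.1, hx.2.trans hs2⟩
  have hmono : Monotone N := by
    intro s t hst
    simp only [hNdef]
    have h : {x | x ∈ X ∧ f x ≤ s} ⊆ {x | x ∈ X ∧ f x ≤ t} := fun x hx => ⟨hx.1, hx.2.trans hst⟩
    exact_mod_cast Set.ncard_le_ncard h (hfin t)
  have hsmall : ∀ t < 1, N t = 0 := by
    intro t ht
    have : {x | x ∈ X ∧ f x ≤ t} = ∅ := by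
      ext x
      simp only [Set.mem_ofPred_eq, Set.mem_empty_iff_false, iff_false, not_and, not_le]
      exact fun hx => ht.trans_le (hf1 x hx)
    simp [hNdef, this]
  obtain ⟨K, hK⟩ : ∃ K : ℝ, ∀ t, 0 < t → N t ≤ K * t := by
    obtain ⟨T, hT⟩ := eventually_atTop.1
      ((hN.eventually_lt_const (lt_add_one c)).and (eventually_gt_atTop 0))
    refine ⟨max (c + 1) (N T), fun t ht => ?_⟩
    rcases le_total T t with h | h
    · have := (hT t h).1
      rw [div_lt_iff₀ ht] at this
      exact this.le.trans (by gcongr; exact le_max_left _ _)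
    · rcases lt_or_ge t 1 with h1 | h1
      · rw [hsmall t h1]
        exact mul_nonneg (le_max_of_le_right (hNnn _)) ht.le
      · calc N t ≤ N T := hmono h
          _ ≤ max (c + 1) (N T) := le_max_right _ _
          _ ≤ max (c + 1) (N T) * t := le_mul_of_one_le_right (le_max_of_le_right (hNnn _)) h1
  have key : Tendsto (fun t : ℝ => ∑' d : ℕ, (ArithmeticFunction.moebius d : ℝ) *
      N (t / (d : ℝ) ^ 2) / t) atTop
      (𝓝 (∑' d : ℕ, (ArithmeticFunction.moebius d : ℝ) / (d : ℝ) ^ 2 * c)) := by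
    refine tendsto_tsum_of_dominated_convergence (bound := fun d : ℕ => K * (1 / (d : ℝ) ^ 2))
      ((Real.summable_one_div_nat_pow.2 one_lt_two).mul_left K) (fun d => ?_) ?_
    · rcases Nat.eq_zero_or_pos d with rfl | hd
      · simp
      · have hd' : (0 : ℝ) < (d : ℝ) ^ 2 := by positivity
        have h := (hN.comp (tendsto_id.atTop_div_const hd')).const_mul
          ((ArithmeticFunction.moebius d : ℝ) / (d : ℝ) ^ 2)
        refine h.congr' ?_
        filter_upwards [eventually_gt_atTop 0] with t ht
        change _ * (N (t / (d : ℝ) ^ 2) / (t / (d : ℝ) ^ 2)) = _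
        generalize N (t / (d : ℝ) ^ 2) = n
        field_simp
    · filter_upwards [eventually_gt_atTop 0] with t ht d
      rcases Nat.eq_zero_or_pos d with rfl | hd
      · simp
      · have hd' : (0 : ℝ) < (d : ℝ) ^ 2 := by positivity
        have h1 : |(ArithmeticFunction.moebius d : ℝ)| ≤ 1 := by
          exact_mod_cast ArithmeticFunction.abs_moebius_le_one (n := d)
        rw [Real.norm_eq_abs, abs_div, abs_mul, abs_of_pos ht, abs_of_nonneg (hNnn _),
          div_le_iff₀ ht]
        calc _ ≤ 1 * N (t / (d : ℝ) ^ 2) := by gcongr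
          _ ≤ K * (t / (d : ℝ) ^ 2) := by rw [one_mul]; exact hK _ (by positivity)
          _ = _ := by ring
  rw [tsum_mul_right, tsum_moebius_div_sq] at key
  refine key.congr fun t => ?_
  rw [tsum_div_const, ncard_isCoprime_eq_tsum_moebius hX hf h0 t (hfin t)]

open MeasureTheory in
theorem volume_setOf_lt_abs_le {a b : ℝ} (ha : 0 ≤ a) :
    volume {v : ℝ | a < |v| ∧ |v| ≤ b} = ENNReal.ofReal (2 * (b - a)) := by
  rcases le_or_gt a b with hab | hab
  · have h : {v : ℝ | a < |v| ∧ |v| ≤ b} = Set.Icc (-b) b \ Set.Icc (-a) a := by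
      ext v
      simp only [Set.mem_ofPred_eq, Set.mem_sdiff, Set.mem_Icc, ← abs_le, not_le]
      tauto
    rw [h, measure_sdiff (Set.Icc_subset_Icc (by linarith) hab) measurableSet_Icc.nullMeasurableSet
      (by simp), Real.volume_Icc, Real.volume_Icc, ← ENNReal.ofReal_sub _ (by linarith)]
    ring_nf
  · rw [ENNReal.ofReal_of_nonpos (by linarith)]
    rw [← measure_empty (μ := (volume : Measure ℝ))]
    congr 1
    ext v
    simp only [Set.mem_ofPred_eq, Set.mem_empty_iff_false, iff_false, not_and, not_le]
    exact fun h => hab.trans h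

theorem integral_min_sub_div_sq {s k : ℝ} (hs : 0 < s) (hk : 1 < k) :
    ∫ u in (0 : ℝ)..(k * s), 2 * (min u (s ^ 2 / u) - u / k ^ 2) = 2 * s ^ 2 * Real.log k := by
  have hks : s ≤ k * s := by nlinarith
  have h1 : Set.EqOn (fun u : ℝ => 2 * (min u (s ^ 2 / u) - u / k ^ 2))
      (fun u => 2 * (u - u / k ^ 2)) (Set.uIoc 0 s) := by
    intro u hu
    rw [Set.uIoc_of_le hs.le] at hu
    have : u ≤ s ^ 2 / u := by rw [le_div_iff₀ hu.1]; nlinarith [hu.1, hu.2]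
    simp only [min_eq_left this]
  have h2 : Set.EqOn (fun u : ℝ => 2 * (min u (s ^ 2 / u) - u / k ^ 2))
      (fun u => 2 * (s ^ 2 * u⁻¹ - u / k ^ 2)) (Set.uIcc s (k * s)) := by
    intro u hu
    rw [Set.uIcc_of_le hks] at hu
    have : s ^ 2 / u ≤ u := by rw [div_le_iff₀ (hs.trans_le hu.1)]; nlinarith [hu.1, hu.2]
    simp only [min_eq_right this]
    rw [div_eq_mul_inv (s ^ 2)]
  have hinv : IntervalIntegrable (fun u : ℝ => u⁻¹) MeasureTheory.volume s (k * s) := by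
    refine intervalIntegral.intervalIntegrable_inv (fun u hu => ?_) continuousOn_id
    rw [Set.uIcc_of_le hks] at hu
    exact (hs.trans_le hu.1).ne'
  have hlin : ∀ a b : ℝ, IntervalIntegrable (fun u : ℝ => u / k ^ 2) MeasureTheory.volume a b :=
    fun a b => (continuous_id.div_const _).intervalIntegrable a b
  have i1 : IntervalIntegrable (fun u : ℝ => 2 * (min u (s ^ 2 / u) - u / k ^ 2))
      MeasureTheory.volume 0 s := by
    refine IntervalIntegrable.congr h1.symm ?_
    exact Continuous.intervalIntegrable (by fun_prop) _ _
  have i2 : IntervalIntegrable (fun u : ℝ => 2 * (min u (s ^ 2 / u) - u / k ^ 2))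
      MeasureTheory.volume s (k * s) := by
    refine IntervalIntegrable.congr (h2.symm.mono Set.uIoc_subset_uIcc) ?_
    exact ((hinv.const_mul _).sub (hlin _ _)).const_mul _
  have hk0 : k ≠ 0 := by positivity
  rw [← intervalIntegral.integral_add_adjacent_intervals i1 i2,
    intervalIntegral.integral_congr_ae (.of_forall h1), intervalIntegral.integral_congr h2,
    intervalIntegral.integral_const_mul, intervalIntegral.integral_const_mul,
    intervalIntegral.integral_sub (by simp) (hlin _ _),
    intervalIntegral.integral_sub (hinv.const_mul _) (hlin _ _),
    intervalIntegral.integral_const_mul, intervalIntegral.integral_div,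
    intervalIntegral.integral_div, integral_inv_of_pos hs (by positivity), integral_id, integral_id,
    mul_div_assoc, div_self hs.ne', mul_one]
  field_simp
  ring

open MeasureTheory in
theorem volume_hyperbolic_sector {s k : ℝ} (hs : 0 < s) (hk : 1 < k) :
    volume {p : ℝ × ℝ | (|p.2| ≤ p.1 ∧ p.1 < k ^ 2 * |p.2|) ∧ |p.1 * p.2| ≤ s ^ 2} =
      ENNReal.ofReal (2 * s ^ 2 * Real.log k) := by
  have hks : 0 < k * s := by positivity
  have hmeas : MeasurableSet
      {p : ℝ × ℝ | (|p.2| ≤ p.1 ∧ p.1 < k ^ 2 * |p.2|) ∧ |p.1 * p.2| ≤ s ^ 2} := by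
    measurability
  rw [Measure.volume_eq_prod, Measure.prod_apply hmeas]
  have hfib : ∀ u : ℝ, volume (Prod.mk u ⁻¹'
      {p : ℝ × ℝ | (|p.2| ≤ p.1 ∧ p.1 < k ^ 2 * |p.2|) ∧ |p.1 * p.2| ≤ s ^ 2}) =
      (Set.Ioc 0 (k * s)).indicator
        (fun u => ENNReal.ofReal (2 * (min u (s ^ 2 / u) - u / k ^ 2))) u := by
    intro u
    rcases le_or_gt u 0 with hu | hu
    · rw [Set.indicator_of_notMem (by simp [hu])]
      rw [← measure_empty (μ := (volume : Measure ℝ))]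
      congr 1
      ext v
      simp only [Set.mem_preimage, Set.mem_ofPred_eq, Set.mem_empty_iff_false, iff_false]
      rintro ⟨⟨h1, h2⟩, -⟩
      have := abs_nonneg v
      have h3 : |v| = 0 := by linarith
      rw [h3] at h2 h1; linarith
    · have hset : (Prod.mk u ⁻¹'
          {p : ℝ × ℝ | (|p.2| ≤ p.1 ∧ p.1 < k ^ 2 * |p.2|) ∧ |p.1 * p.2| ≤ s ^ 2}) =
          {v : ℝ | u / k ^ 2 < |v| ∧ |v| ≤ min u (s ^ 2 / u)} := by
        ext v
        simp only [Set.mem_preimage, Set.mem_ofPred_eq, le_min_iff, le_div_iff₀ hu,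
          div_lt_iff₀ (by positivity : 0 < k ^ 2), abs_mul, abs_of_pos hu, mul_comm u,
          mul_comm (k ^ 2)]
        tauto
      rw [hset, volume_setOf_lt_abs_le (by positivity)]
      rcases le_or_gt u (k * s) with h | h
      · rw [Set.indicator_of_mem (by exact ⟨hu, h⟩)]
      · rw [Set.indicator_of_notMem (by simp [h])]
        refine ENNReal.ofReal_of_nonpos ?_
        have : s ^ 2 / u ≤ u / k ^ 2 := by
          rw [div_le_div_iff₀ hu (by positivity)]
          nlinarith
        linarith [min_le_right u (s ^ 2 / u)]
  simp_rw [hfib]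
  rw [lintegral_indicator measurableSet_Ioc, ← integral_min_sub_div_sq hs hk,
    intervalIntegral.integral_of_le hks.le, ofReal_integral_eq_lintegral_ofReal]
  · have := intervalIntegral.intervalIntegrable_of_integral_ne_zero (μ := volume)
      (a := 0) (b := k * s) (f := fun u : ℝ => 2 * (min u (s ^ 2 / u) - u / k ^ 2)) (by
        rw [integral_min_sub_div_sq hs hk]
        have := Real.log_pos hk
        positivity)
    exact (intervalIntegrable_iff_integrableOn_Ioc_of_le hks.le).1 this
  · refine (ae_restrict_iff' measurableSet_Ioc).2 (Filter.Eventually.of_forall fun u hu => ?_)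
    have h1 : u / k ^ 2 ≤ u := div_le_self hu.1.le (by nlinarith)
    have h2 : u / k ^ 2 ≤ s ^ 2 / u := by
      rw [div_le_div_iff₀ (by positivity) hu.1]
      nlinarith [hu.1, hu.2]
    have := le_min h1 h2
    simp only [Pi.zero_apply]
    linarith

open MeasureTheory in
theorem volume_hyperbolic_sector_boundary {s k : ℝ} (hk : 1 < k) :
    volume {p : ℝ × ℝ | (|p.2| = p.1 ∨ p.1 = k ^ 2 * |p.2|) ∨ |p.1 * p.2| = s ^ 2} = 0 := by
  have hmeas : MeasurableSet
      {p : ℝ × ℝ | (|p.2| = p.1 ∨ p.1 = k ^ 2 * |p.2|) ∨ |p.1 * p.2| = s ^ 2} := by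
    refine IsClosed.measurableSet ?_
    refine ((isClosed_eq ?_ ?_).union (isClosed_eq ?_ ?_)).union (isClosed_eq ?_ ?_) <;> fun_prop
  rw [Measure.volume_eq_prod, Measure.measure_prod_null hmeas]
  have h0 : ∀ᵐ u : ℝ, u ≠ 0 := by simp [ae_iff]
  filter_upwards [h0] with u hu
  have hk0 : k ^ 2 ≠ 0 := by positivity
  refine (Set.Finite.subset (Set.toFinite {u, -u, u / k ^ 2, -(u / k ^ 2), s ^ 2 / u, -(s ^ 2 / u)})
    fun v hv => ?_).measure_zero volume
  simp only [Set.mem_preimage, Set.mem_ofPred_eq] at hv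
  simp only [Set.mem_insert_iff, Set.mem_singleton_iff]
  rcases hv with (h | h) | h
  · rcases abs_choice v with h' | h' <;> rw [h'] at h
    · tauto
    · right; left; linarith
  · rcases abs_choice v with h' | h' <;> rw [h'] at h
    · right; right; left; field_simp; linarith
    · right; right; right; left; field_simp; linarith
  · rcases abs_choice (u * v) with h' | h' <;> rw [h'] at h
    · right; right; right; right; left; field_simp; linarith
    · right; right; right; right; right; field_simp; linarith

theorem formComp_mul (A B C : ℤ) (g h : SL2Z) :
    formComp A B C (g * h) =
      formComp (formComp A B C g).1 (formComp A B C g).2.1 (formComp A B C g).2.2 h := by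
  simp only [formComp, Matrix.SpecialLinearGroup.coe_mul, Matrix.mul_apply, Fin.sum_univ_two,
    Prod.mk.injEq]
  refine ⟨?_, ?_, ?_⟩ <;> ring

theorem formComp_one (A B C : ℤ) : formComp A B C 1 = (A, B, C) := by
  simp [formComp]

theorem actPair_mul (g h : SL2Z) (x : ℤ × ℤ) : actPair (g * h) x = actPair g (actPair h x) := by
  simp only [actPair, Matrix.SpecialLinearGroup.coe_mul, Matrix.mul_apply, Fin.sum_univ_two,
    Prod.mk.injEq]
  constructor <;> ring

theorem actPair_one (x : ℤ × ℤ) : actPair 1 x = x := by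
  simp [actPair]

/-- The group of integral automorphs of the form `(A, B, C)`. -/
def automorphGroup (A B C : ℤ) : Subgroup SL2Z where
  carrier := {g | formComp A B C g = (A, B, C)}
  mul_mem' {g h} hg hh := by
    simp only [Set.mem_ofPred_eq] at hg hh ⊢
    rw [formComp_mul, hg, hh]
  one_mem' := formComp_one A B C
  inv_mem' {g} hg := by
    simp only [Set.mem_ofPred_eq] at hg ⊢
    have h := formComp_mul A B C g g⁻¹
    rw [mul_inv_cancel, formComp_one, hg] at h
    exact h.symm

theorem mem_automorphGroup {A B C : ℤ} {g : SL2Z} :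
    g ∈ automorphGroup A B C ↔ formComp A B C g = (A, B, C) := Iff.rfl

theorem Qval_actPair (A B C : ℤ) (g : SL2Z) (x : ℤ × ℤ) :
    Qval A B C (actPair g x) =
      Qval (formComp A B C g).1 (formComp A B C g).2.1 (formComp A B C g).2.2 x := by
  simp only [Qval, actPair, formComp]
  ring

theorem SL2Z_det_eq_one (g : SL2Z) : g.1 0 0 * g.1 1 1 - g.1 0 1 * g.1 1 0 = 1 := by
  rw [← Matrix.det_fin_two, g.2]

theorem isCoprime_actPair (g : SL2Z) {x : ℤ × ℤ} (hx : IsCoprime x.1 x.2) :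
    IsCoprime (actPair g x).1 (actPair g x).2 := by
  obtain ⟨a, b, h⟩ := hx
  refine ⟨a * g.1 1 1 - b * g.1 1 0, b * g.1 0 0 - a * g.1 0 1, ?_⟩
  simp only [actPair]
  linear_combination h + (a * x.1 + b * x.2) * SL2Z_det_eq_one g

/-- The automorphs of a primitive form come from solutions of the Pell equation. -/
theorem exists_pell_of_mem_automorphGroup {A B C : ℤ} (hA : A ≠ 0)
    (hprim : Int.gcd A (Int.gcd B C) = 1) {g : SL2Z} (hg : g ∈ automorphGroup A B C) :
    ∃ t u : ℤ, t ^ 2 - (B ^ 2 - 4 * A * C) * u ^ 2 = 4 ∧ 2 * g.1 0 0 = t - B * u ∧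
      g.1 0 1 = -(C * u) ∧ g.1 1 0 = A * u ∧ 2 * g.1 1 1 = t + B * u := by
  have hdet := SL2Z_det_eq_one g
  simp only [mem_automorphGroup, formComp, Prod.mk.injEq] at hg
  generalize g.1 0 0 = a at *
  generalize g.1 0 1 = b at *
  generalize g.1 1 0 = c at *
  generalize g.1 1 1 = d at *
  obtain ⟨h1, h2, h3⟩ := hg
  have e1 : A * (d - a) = B * c := by
    have : 2 * (A * (d - a)) = 2 * (B * c) := by
      linear_combination (-2 * d) * h1 + c * h2 + (2 * A * a + B * c) * hdet
    linarith
  have e2 : A * b = -(C * c) := by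
    have : 2 * (A * b) = 2 * -(C * c) := by
      linear_combination d * h2 - 2 * c * h3 - (2 * A * b + B * d) * hdet
    linarith
  obtain ⟨u, hu⟩ : A ∣ c := by
    have hBC : A ∣ (Int.gcd B C : ℤ) * c := by
      have hB : A ∣ B * c := ⟨_, e1.symm⟩
      have hC : A ∣ C * c := ⟨-b, by linear_combination e2⟩
      rw [Int.gcd_eq_gcd_ab B C]
      have := (hB.mul_left (Int.gcdA B C)).add (hC.mul_left (Int.gcdB B C))
      rwa [show (B * B.gcdA C + C * B.gcdB C) * c = B.gcdA C * (B * c) + B.gcdB C * (C * c) by ring]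
    exact (Int.isCoprime_iff_gcd_eq_one.2 hprim).dvd_of_dvd_mul_left hBC
  subst hu
  have e3 : d - a = B * u := mul_left_cancel₀ hA (by linear_combination e1)
  have e4 : b = -(C * u) := mul_left_cancel₀ hA (by linear_combination e2)
  refine ⟨a + d, u, ?_, by linear_combination -e3, e4, rfl, by linear_combination e3⟩
  subst e4
  linear_combination 4 * hdet + (d - a + B * u) * e3

/-- The automorph attached to a solution of the Pell equation. -/
theorem exists_automorph_of_pell {A B C t u : ℤ}
    (h : t ^ 2 - (B ^ 2 - 4 * A * C) * u ^ 2 = 4) :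
    ∃ g ∈ automorphGroup A B C, 2 * g.1 0 0 = t - B * u ∧
      g.1 0 1 = -(C * u) ∧ g.1 1 0 = A * u ∧ 2 * g.1 1 1 = t + B * u := by
  have hev : Even (t - B * u) := by
    have h2 : Even ((t - B * u) * (t + B * u)) := by
      refine ⟨2 * (1 - A * C * u ^ 2), ?_⟩
      linear_combination h
    rcases Int.even_mul.1 h2 with h3 | h3
    · exact h3
    · have : t - B * u = t + B * u - 2 * (B * u) := by ring
      rw [this]
      exact h3.sub (even_two_mul _)
  obtain ⟨a, ha⟩ := hev
  obtain rfl : t = 2 * a + B * u := by linear_combination ha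
  have hd : a ^ 2 + B * a * u + A * C * u ^ 2 = 1 := by linarith
  have hdet : Matrix.det !![a, -(C * u); A * u, a + B * u] = 1 := by
    rw [Matrix.det_fin_two_of]
    linear_combination hd
  obtain ⟨g, hg⟩ : ∃ g : SL2Z, g.1 = !![a, -(C * u); A * u, a + B * u] := ⟨⟨_, hdet⟩, rfl⟩
  refine ⟨g, ?_, ?_⟩
  · rw [mem_automorphGroup]
    simp only [formComp, hg, Matrix.of_apply, Matrix.cons_val', Matrix.cons_val_zero,
      Matrix.cons_val_one, Matrix.cons_val_fin_one, Prod.mk.injEq]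
    refine ⟨?_, ?_, ?_⟩
    · linear_combination A * hd
    · linear_combination B * hd
    · linear_combination C * hd
  · simp only [hg, Matrix.of_apply, Matrix.cons_val', Matrix.cons_val_zero,
      Matrix.cons_val_one, Matrix.cons_val_fin_one, true_and]
    constructor <;> ring

/-- The linear factors of the form `(A, B, C)`: the product of `linForm A B δ` and
`linForm A B (-δ)` is `4 * A` times the form when `δ ^ 2` is its discriminant. -/
def linForm (A B : ℤ) (δ : ℝ) (x : ℤ × ℤ) : ℝ := 2 * A * x.1 + (B + δ) * x.2

theorem linForm_mul_linForm {A B C : ℤ} {δ : ℝ} (hδ : δ ^ 2 = B ^ 2 - 4 * A * C) (x : ℤ × ℤ) :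
    linForm A B δ x * linForm A B (-δ) x = 4 * A * (Qval A B C x : ℝ) := by
  simp only [linForm, Qval]
  push_cast
  linear_combination (-(x.2 : ℝ) ^ 2) * hδ

theorem linForm_actPair {A B C t u : ℤ} {δ : ℝ} (hδ : δ ^ 2 = B ^ 2 - 4 * A * C) {g : SL2Z}
    (h₁ : 2 * g.1 0 0 = t - B * u) (h₂ : g.1 0 1 = -(C * u)) (h₃ : g.1 1 0 = A * u)
    (h₄ : 2 * g.1 1 1 = t + B * u) (x : ℤ × ℤ) :
    linForm A B δ (actPair g x) = (t + u * δ) / 2 * linForm A B δ x := by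
  have h₁' : (2 * g.1 0 0 : ℝ) = t - B * u := by exact_mod_cast h₁
  have h₄' : (2 * g.1 1 1 : ℝ) = t + B * u := by exact_mod_cast h₄
  simp only [linForm, actPair, h₂, h₃]
  push_cast
  linear_combination (A * x.1 : ℝ) * h₁' + ((B + δ) * x.2 / 2) * h₄' - (u * x.2 / 2 : ℝ) * hδ

theorem linForm_actPair_zpow {A B : ℤ} {δ η : ℝ} (hη : η ≠ 0) {g : SL2Z}
    (hg : ∀ x, linForm A B δ (actPair g x) = η * linForm A B δ x) (n : ℤ) (x : ℤ × ℤ) :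
    linForm A B δ (actPair (g ^ n) x) = η ^ n * linForm A B δ x := by
  have hinv : ∀ x, linForm A B δ (actPair g⁻¹ x) = η⁻¹ * linForm A B δ x := by
    intro x
    have h := hg (actPair g⁻¹ x)
    rw [← actPair_mul, mul_inv_cancel, actPair_one] at h
    rw [h, inv_mul_cancel_left₀ hη]
  induction n generalizing x with
  | zero => simp [actPair_one]
  | succ n ih => rw [zpow_add_one, actPair_mul, ih, hg, zpow_add_one₀ hη, mul_assoc]
  | pred n ih => rw [zpow_sub_one, actPair_mul, ih, hinv, zpow_sub_one₀ hη, mul_assoc]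

/-- A fundamental domain for the action of the automorphs, where `k` is the fundamental unit. -/
def sectorSet (A B : ℤ) (δ k : ℝ) : Set (ℤ × ℤ) :=
  {x | |linForm A B (-δ) x| ≤ linForm A B δ x ∧ linForm A B δ x < k ^ 2 * |linForm A B (-δ) x|}

theorem linForm_pos_of_mem_sectorSet {A B : ℤ} {δ k : ℝ} {x : ℤ × ℤ}
    (hx : x ∈ sectorSet A B δ k) : 0 < |linForm A B (-δ) x| := by
  refine (abs_nonneg _).lt_of_ne fun h => ?_
  have h1 := hx.1
  have h2 := hx.2
  rw [← h] at h1 h2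
  linarith

theorem leadingCoeff_ne_zero {A B C : ℤ} (hnsq : ¬ IsSquare (B ^ 2 - 4 * A * C)) : A ≠ 0 := by
  rintro rfl
  exact hnsq ⟨B, by ring⟩

theorem Qval_ne_zero {A B C : ℤ} (hnsq : ¬ IsSquare (B ^ 2 - 4 * A * C)) {x : ℤ × ℤ}
    (hx : x ≠ 0) : Qval A B C x ≠ 0 := by
  intro h
  have hA := leadingCoeff_ne_zero hnsq
  have h1 : (2 * A * x.1 + B * x.2) ^ 2 = x.2 ^ 2 * (B ^ 2 - 4 * A * C) := by
    simp only [Qval] at h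
    linear_combination 4 * A * h
  rcases eq_or_ne x.2 0 with h2 | h2
  · rw [h2] at h1
    have h3 : x.1 = 0 := by simpa [hA] using h1
    exact hx (Prod.ext h3 h2)
  · obtain ⟨m, hm⟩ := (Int.pow_dvd_pow_iff two_ne_zero).1 (Dvd.intro _ h1.symm)
    rw [hm, mul_pow] at h1
    exact hnsq ⟨m, by rw [← pow_two]; exact (mul_left_cancel₀ (pow_ne_zero 2 h2) h1).symm⟩

theorem exists_automorph_actPair_mem_sectorSet {A B C : ℤ}
    (hnsq : ¬ IsSquare (B ^ 2 - 4 * A * C)) {δ : ℝ} (hδ : δ ^ 2 = B ^ 2 - 4 * A * C)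
    {t u : ℤ} (h : t ^ 2 - (B ^ 2 - 4 * A * C) * u ^ 2 = 4)
    (hk : 1 < (t + u * δ) / 2) {x : ℤ × ℤ} (hx : x ≠ 0) :
    ∃ g ∈ automorphGroup A B C, actPair g x ∈ sectorSet A B δ ((t + u * δ) / 2) := by
  set k : ℝ := (t + u * δ) / 2 with hkdef
  have hk0 : 0 < k := by linarith
  have hkinv : (t + u * (-δ)) / 2 = k⁻¹ := by
    have hR : (t : ℝ) ^ 2 - (B ^ 2 - 4 * A * C) * u ^ 2 = 4 := by exact_mod_cast h
    refine eq_inv_of_mul_eq_one_left ?_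
    rw [hkdef]
    linear_combination hR / 4 - (u : ℝ) ^ 2 / 4 * hδ
  have hprod : linForm A B δ x * linForm A B (-δ) x ≠ 0 := by
    rw [linForm_mul_linForm hδ]
    have h1 := Qval_ne_zero hnsq hx
    have h2 := leadingCoeff_ne_zero hnsq
    have h1' : (Qval A B C x : ℝ) ≠ 0 := by exact_mod_cast h1
    have h2' : (A : ℝ) ≠ 0 := by exact_mod_cast h2
    positivity
  have hneg : ∀ δ' : ℝ, linForm A B δ' (actPair (-1) x) = -linForm A B δ' x := by
    intro δ'
    simp [linForm, actPair]
    ring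
  obtain ⟨s, hs, hsU, hsV⟩ : ∃ s ∈ automorphGroup A B C, 0 < linForm A B δ (actPair s x) ∧
      linForm A B (-δ) (actPair s x) ≠ 0 := by
    rcases lt_or_gt_of_ne (left_ne_zero_of_mul hprod) with h1 | h1
    · refine ⟨-1, ?_, ?_, ?_⟩
      · simp [mem_automorphGroup, formComp]
      · rw [hneg]; linarith
      · rw [hneg]; exact neg_ne_zero.2 (right_ne_zero_of_mul hprod)
    · refine ⟨1, one_mem _, ?_, ?_⟩ <;> rw [actPair_one]
      · exact h1
      · exact right_ne_zero_of_mul hprod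
  set y := actPair s x with hy
  obtain ⟨g, hg, h1, h2, h3, h4⟩ := exists_automorph_of_pell h
  have hgU := linForm_actPair hδ h1 h2 h3 h4
  have hgV := linForm_actPair (δ := -δ) (by rw [neg_sq, hδ]) h1 h2 h3 h4
  rw [← hkdef] at hgU
  rw [hkinv] at hgV
  have hVpos : 0 < |linForm A B (-δ) y| := abs_pos.2 hsV
  obtain ⟨n, hn1, hn2⟩ := exists_mem_Ico_zpow (div_pos hsU hVpos) (one_lt_pow₀ hk two_ne_zero)
  refine ⟨g ^ (-n) * s, mul_mem (zpow_mem hg _) hs, ?_⟩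
  rw [actPair_mul, ← hy]
  rw [le_div_iff₀ hVpos] at hn1
  rw [div_lt_iff₀ hVpos, zpow_add_one₀ (by positivity)] at hn2
  have hkn : 0 < k ^ n := zpow_pos hk0 n
  have hsq : (k ^ 2) ^ n = k ^ n * k ^ n := by rw [← mul_zpow, pow_two]
  rw [hsq] at hn1 hn2
  simp only [sectorSet, Set.mem_ofPred_eq]
  rw [linForm_actPair_zpow hk0.ne' hgU, linForm_actPair_zpow (inv_ne_zero hk0.ne') hgV, abs_mul,
    inv_zpow', neg_neg, abs_of_pos hkn, zpow_neg, inv_mul_eq_div]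
  constructor
  · rw [le_div_iff₀ hkn]; linarith
  · rw [div_lt_iff₀ hkn]; linarith

theorem eq_of_mem_sectorSet_of_automorph {A B C : ℤ} (hprim : Int.gcd A (Int.gcd B C) = 1)
    (hnsq : ¬ IsSquare (B ^ 2 - 4 * A * C)) {δ : ℝ} (hδ : δ ^ 2 = B ^ 2 - 4 * A * C) (hδ0 : 0 < δ)
    {t₀ u₀ : ℤ} (ht₀ : 0 < t₀) (hu₀ : 0 < u₀) (h₀ : t₀ ^ 2 - (B ^ 2 - 4 * A * C) * u₀ ^ 2 = 4)
    (hmin : ∀ t u : ℤ, 0 < t → 0 < u → t ^ 2 - (B ^ 2 - 4 * A * C) * u ^ 2 = 4 → u₀ ≤ u)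
    {x : ℤ × ℤ} (hx : x ∈ sectorSet A B δ ((t₀ + u₀ * δ) / 2)) {g : SL2Z}
    (hg : g ∈ automorphGroup A B C)
    (hgx : actPair g x ∈ sectorSet A B δ ((t₀ + u₀ * δ) / 2)) : actPair g x = x := by
  set k : ℝ := (t₀ + u₀ * δ) / 2 with hkdef
  have ht₀' : (0 : ℝ) < t₀ := by exact_mod_cast ht₀
  have hu₀' : (0 : ℝ) < u₀ := by exact_mod_cast hu₀
  have hk0 : 0 < k := by positivity
  obtain ⟨t, u, hp, h1, h2, h3, h4⟩ :=
    exists_pell_of_mem_automorphGroup (leadingCoeff_ne_zero hnsq) hprim hg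
  have hgU := linForm_actPair hδ h1 h2 h3 h4 x
  have hgV := linForm_actPair (δ := -δ) (by rw [neg_sq, hδ]) h1 h2 h3 h4 x
  have hVx := linForm_pos_of_mem_sectorSet hx
  have hVy := linForm_pos_of_mem_sectorSet hgx
  have hUx := hVx.trans_le hx.1
  have hUy := hVy.trans_le hgx.1
  obtain ⟨hx1, hx2⟩ := hx
  obtain ⟨hy1, hy2⟩ := hgx
  have hprod : ((t + u * δ) / 2 : ℝ) * ((t + u * (-δ)) / 2) = 1 := by
    have hR : (t : ℝ) ^ 2 - (B ^ 2 - 4 * A * C) * u ^ 2 = 4 := by exact_mod_cast hp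
    linear_combination hR / 4 - (u : ℝ) ^ 2 / 4 * hδ
  rw [hgU] at hUy hy1 hy2
  have hη : 0 < ((t + u * δ) / 2 : ℝ) := pos_of_mul_pos_left hUy hUx.le
  have hη' : 0 < ((t + u * (-δ)) / 2 : ℝ) := pos_of_mul_pos_right (hprod ▸ one_pos) hη.le
  rw [hgV, abs_mul, abs_of_pos hη'] at hy1 hy2
  have hlt : ((t + u * δ) / 2 : ℝ) < k := by
    have h5 : ((t + u * δ) / 2 : ℝ) < k ^ 2 * ((t + u * (-δ)) / 2) := by
      refine lt_of_mul_lt_mul_right (hy2.trans_le ?_) hUx.le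
      rw [← mul_assoc]
      gcongr
    refine lt_of_pow_lt_pow_left₀ 2 hk0.le ?_
    calc ((t + u * δ) / 2 : ℝ) ^ 2 < ((t + u * δ) / 2) * (k ^ 2 * ((t + u * (-δ)) / 2)) := by
          rw [pow_two]; gcongr
      _ = k ^ 2 := by linear_combination k ^ 2 * hprod
  have hlt' : ((t + u * (-δ)) / 2 : ℝ) < k := by
    have h5 : ((t + u * (-δ)) / 2 : ℝ) < k ^ 2 * ((t + u * δ) / 2) := by
      refine lt_of_mul_lt_mul_right (hy1.trans_lt ?_) hVx.le
      calc _ < ((t + u * δ) / 2 : ℝ) * (k ^ 2 * |linForm A B (-δ) x|) := by gcongr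
        _ = _ := by ring
    refine lt_of_pow_lt_pow_left₀ 2 hk0.le ?_
    calc ((t + u * (-δ)) / 2 : ℝ) ^ 2 < ((t + u * (-δ)) / 2) * (k ^ 2 * ((t + u * δ) / 2)) := by
          rw [pow_two]; gcongr
      _ = k ^ 2 := by linear_combination k ^ 2 * hprod
  have ht : 0 < t := by
    have : (0 : ℝ) < t := by linarith
    exact_mod_cast this
  have hD : 0 < B ^ 2 - 4 * A * C := by
    have : (0 : ℝ) < B ^ 2 - 4 * A * C := hδ ▸ by positivity
    exact_mod_cast this
  have hle : ∀ u' : ℤ, 0 < u' → t ^ 2 - (B ^ 2 - 4 * A * C) * u' ^ 2 = 4 →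
      k ≤ (t + u' * δ) / 2 := by
    intro u' hu' hp'
    have h5 := hmin t u' ht hu' hp'
    have h6 : t₀ ≤ t := by
      refine (pow_le_pow_iff_left₀ ht₀.le ht.le two_ne_zero).1 ?_
      have : u₀ ^ 2 ≤ u' ^ 2 := by gcongr
      nlinarith
    have h5' : (u₀ : ℝ) ≤ u' := by exact_mod_cast h5
    have h6' : (t₀ : ℝ) ≤ t := by exact_mod_cast h6
    rw [hkdef]
    gcongr
  have hu : u = 0 := by
    rcases lt_trichotomy u 0 with h5 | h5 | h5
    · have h6 := hle (-u) (by omega) (by rw [neg_sq]; exact hp)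
      push_cast at h6
      linarith
    · exact h5
    · exact absurd (hle u h5 hp) (not_le.2 hlt)
  subst hu
  have ht2 : t = 2 := by nlinarith
  subst ht2
  have e1 : g.1 0 0 = 1 := by linarith
  have e2 : g.1 1 1 = 1 := by linarith
  simp [actPair, h2, h3, e1, e2]

theorem Psi_eq_ncard {A B C : ℤ} (hprim : Int.gcd A (Int.gcd B C) = 1)
    (hnsq : ¬ IsSquare (B ^ 2 - 4 * A * C)) {δ : ℝ} (hδ : δ ^ 2 = B ^ 2 - 4 * A * C) (hδ0 : 0 < δ)
    {t₀ u₀ : ℤ} (ht₀ : 0 < t₀) (hu₀ : 0 < u₀) (h₀ : t₀ ^ 2 - (B ^ 2 - 4 * A * C) * u₀ ^ 2 = 4)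
    (hmin : ∀ t u : ℤ, 0 < t → 0 < u → t ^ 2 - (B ^ 2 - 4 * A * C) * u ^ 2 = 4 → u₀ ≤ u)
    (hk : 1 < (t₀ + u₀ * δ) / 2) (t : ℝ) :
    Psi A B C t = {x : ℤ × ℤ | IsCoprime x.1 x.2 ∧ x ∈ sectorSet A B δ ((t₀ + u₀ * δ) / 2) ∧
      ((|Qval A B C x| : ℤ) : ℝ) ≤ t}.ncard := by
  have hQ : ∀ g ∈ automorphGroup A B C, ∀ x, Qval A B C (actPair g x) = Qval A B C x := by
    intro g hg x
    rw [Qval_actPair, mem_automorphGroup.1 hg]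
  rw [Psi, ← Nat.card_coe_set_eq]
  symm
  refine Nat.card_eq_of_bijective (fun x => Quot.mk _ ⟨x.1, x.2.1, x.2.2.2⟩) ⟨?_, ?_⟩
  · rintro ⟨x, hx1, hx2, hx3⟩ ⟨y, hy1, hy2, hy3⟩ hxy
    have key : ∃ g ∈ automorphGroup A B C, y = actPair g x := by
      have := Quot.eqvGen_exact hxy
      generalize hx' : (⟨x, _⟩ : {x : ℤ × ℤ // IsCoprime x.1 x.2 ∧
        ((|Qval A B C x| : ℤ) : ℝ) ≤ t}) = x' at this
      generalize hy' : (⟨y, _⟩ : {x : ℤ × ℤ // IsCoprime x.1 x.2 ∧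
        ((|Qval A B C x| : ℤ) : ℝ) ≤ t}) = y' at this
      have h : ∃ g ∈ automorphGroup A B C, y'.1 = actPair g x'.1 := by
        clear hx' hy'
        induction this with
        | rel a b hab => exact hab
        | refl a => exact ⟨1, one_mem _, (actPair_one _).symm⟩
        | symm a b _ ih =>
          obtain ⟨g, hg, h⟩ := ih
          exact ⟨g⁻¹, inv_mem hg, by rw [h, ← actPair_mul, inv_mul_cancel, actPair_one]⟩
        | trans a b c _ _ ih₁ ih₂ =>
          obtain ⟨g₁, hg₁, h₁⟩ := ih₁
          obtain ⟨g₂, hg₂, h₂⟩ := ih₂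
          exact ⟨g₂ * g₁, mul_mem hg₂ hg₁, by rw [h₂, h₁, actPair_mul]⟩
      rwa [← hx', ← hy'] at h
    obtain ⟨g, hg, rfl⟩ := key
    exact Subtype.ext (eq_of_mem_sectorSet_of_automorph hprim hnsq hδ hδ0 ht₀ hu₀ h₀ hmin hx2 hg
      hy2).symm
  · rintro ⟨⟨x, hx1, hx2⟩⟩
    have hx0 : x ≠ 0 := by
      rintro rfl
      simp [isCoprime_zero_left] at hx1
    obtain ⟨g, hg, hgx⟩ :=
      exists_automorph_actPair_mem_sectorSet hnsq hδ h₀ hk hx0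
    refine ⟨⟨actPair g x, isCoprime_actPair g hx1, hgx, by rwa [hQ g hg]⟩, ?_⟩
    exact (Quot.sound ⟨g, hg, rfl⟩).symm

open MeasureTheory in
/-- The linear change of variables given by the two real linear factors of a form. -/
theorem volume_setOf_linear_mem {a b δ : ℝ} (ha : a ≠ 0) (hδ : 0 < δ) (S : Set (ℝ × ℝ)) :
    volume {x : Fin 2 → ℝ | (2 * a * x 0 + (b + δ) * x 1, 2 * a * x 0 + (b + -δ) * x 1) ∈ S} =
      ENNReal.ofReal (4 * |a| * δ)⁻¹ * volume S := by
  let T : (Fin 2 → ℝ) →ₗ[ℝ] (Fin 2 → ℝ) := Matrix.toLin' !![2 * a, b + δ; 2 * a, b + -δ]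
  have hdet : LinearMap.det T = -(4 * a * δ) := by
    rw [LinearMap.det_toLin', Matrix.det_fin_two_of]
    ring
  have hdet0 : LinearMap.det T ≠ 0 := by
    rw [hdet]
    have := hδ.ne'
    simp [ha, this]
  have hset : {x : Fin 2 → ℝ |
      (2 * a * x 0 + (b + δ) * x 1, 2 * a * x 0 + (b + -δ) * x 1) ∈ S} =
      T ⁻¹' (MeasurableEquiv.finTwoArrow ⁻¹' S) := by
    ext x
    simp [T, Matrix.toLin'_apply, dotProduct, Fin.sum_univ_two]
  rw [hset, Measure.addHaar_preimage_linearMap _ hdet0,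
    (volume_preserving_finTwoArrow ℝ).measure_preimage_equiv, hdet, abs_inv, abs_neg, abs_mul,
    abs_mul, abs_of_pos hδ]
  norm_num

theorem abs_linear_le_of_mem {k s U V : ℝ} (hk : 1 < k) (hs : 0 < s)
    (h : (|V| ≤ U ∧ U < k ^ 2 * |V|) ∧ |U * V| ≤ s ^ 2) : |U| ≤ k * s ∧ |V| ≤ k * s := by
  obtain ⟨⟨h1, h2⟩, h3⟩ := h
  have h0 := abs_nonneg V
  have hU : 0 ≤ U := h0.trans h1
  rw [abs_mul, abs_of_nonneg hU] at h3
  have h4 : U ≤ k * s := by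
    refine (pow_le_pow_iff_left₀ hU (by positivity) two_ne_zero).1 ?_
    rw [mul_pow]
    nlinarith [sq_nonneg k]
  exact ⟨by rwa [abs_of_nonneg hU], h1.trans h4⟩

open MeasureTheory Filter Topology in
/-- The integral points of a sector on which the form is bounded by `t`. -/
theorem tendsto_ncard_sectorSet_div {A B C : ℤ} (hA : A ≠ 0) {δ k : ℝ}
    (hδ : δ ^ 2 = B ^ 2 - 4 * A * C) (hδ0 : 0 < δ) (hk : 1 < k) :
    Tendsto (fun t : ℝ =>
      (({x | x ∈ sectorSet A B δ k ∧ ((|Qval A B C x| : ℤ) : ℝ) ≤ t}.ncard : ℕ) : ℝ) / t) atTop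
      (𝓝 (2 * Real.log k / δ)) := by
  have hA' : (A : ℝ) ≠ 0 := by exact_mod_cast hA
  let L : Submodule ℤ (Fin 2 → ℝ) := Submodule.span ℤ (Set.range (Pi.basisFun ℝ (Fin 2)))
  let U : (Fin 2 → ℝ) → ℝ := fun x => 2 * A * x 0 + (B + δ) * x 1
  let V : (Fin 2 → ℝ) → ℝ := fun x => 2 * A * x 0 + (B + -δ) * x 1
  let F : (Fin 2 → ℝ) → ℝ := fun x => |A * x 0 ^ 2 + B * x 0 * x 1 + C * x 1 ^ 2|
  let X : Set (Fin 2 → ℝ) := {x | |V x| ≤ U x ∧ U x < k ^ 2 * |V x|}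
  have hUc : Continuous U := by fun_prop
  have hVc : Continuous V := by fun_prop
  have hFc : Continuous F := by fun_prop
  set s : ℝ := √(4 * |A|) with hs
  have hs2 : s ^ 2 = 4 * |A| := Real.sq_sqrt (by positivity)
  have hs0 : 0 < s := Real.sqrt_pos.2 (by positivity)
  have hUV : ∀ x, |U x * V x| = s ^ 2 * F x := by
    intro x
    have : U x * V x = 4 * A * (A * x 0 ^ 2 + B * x 0 * x 1 + C * x 1 ^ 2) := by
      simp only [U, V]
      linear_combination (-(x 1) ^ 2) * hδ
    rw [this, abs_mul, abs_mul, hs2]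
    simp [F]
  have hF1 : ∀ x, F x ≤ 1 ↔ |U x * V x| ≤ s ^ 2 := by
    intro x
    rw [hUV]
    exact (mul_le_iff_le_one_right (by positivity)).symm
  have hF1' : ∀ x, F x = 1 ↔ |U x * V x| = s ^ 2 := by
    intro x
    rw [hUV]
    exact (mul_eq_left₀ (by positivity)).symm
  have hW : {x | x ∈ X ∧ F x ≤ 1} = {x : Fin 2 → ℝ | (U x, V x) ∈
      {p : ℝ × ℝ | (|p.2| ≤ p.1 ∧ p.1 < k ^ 2 * |p.2|) ∧ |p.1 * p.2| ≤ s ^ 2}} := by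
    ext x
    simp only [X, Set.mem_ofPred_eq, hF1]
  have hvol : volume.real {x | x ∈ X ∧ F x ≤ 1} = 2 * Real.log k / δ := by
    have hlog := Real.log_pos hk
    rw [hW, measureReal_def, volume_setOf_linear_mem hA' hδ0, volume_hyperbolic_sector hs0 hk,
      ← ENNReal.ofReal_mul (by positivity), ENNReal.toReal_ofReal (by positivity), hs2]
    have : |(A : ℝ)| ≠ 0 := abs_ne_zero.2 hA'
    push_cast
    field_simp
  have hbdd : Bornology.IsBounded {x | x ∈ X ∧ F x ≤ 1} := by
    refine (Metric.isBounded_closedBall (x := (0 : Fin 2 → ℝ))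
      (r := max ((k * s + |B + δ| * (k * s / δ)) / (2 * |A|)) (k * s / δ))).subset ?_
    intro x hx
    rw [hW] at hx
    obtain ⟨h1, h2⟩ := abs_linear_le_of_mem hk hs0 hx
    have h3 : |x 1| ≤ k * s / δ := by
      have e : x 1 = (U x - V x) / (2 * δ) := by
        simp only [U, V]
        field_simp
        ring
      rw [e, abs_div, abs_of_pos (by positivity : 0 < 2 * δ), div_le_div_iff₀ (by positivity) hδ0]
      have := abs_sub (U x) (V x)
      nlinarith
    have h4 : |x 0| ≤ (k * s + |B + δ| * (k * s / δ)) / (2 * |A|) := by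
      have e : x 0 = (U x - (B + δ) * x 1) / (2 * A) := by
        simp only [U]
        field_simp
        ring
      rw [e, abs_div, abs_mul, abs_two]
      push_cast
      gcongr
      refine (abs_sub _ _).trans ?_
      rw [abs_mul]
      gcongr
    rw [mem_closedBall_zero_iff, pi_norm_le_iff_of_nonneg (le_max_of_le_right (by positivity))]
    intro i
    fin_cases i
    · exact h4.trans (le_max_left _ _)
    · exact h3.trans (le_max_right _ _)
  have hmeas : MeasurableSet {x | x ∈ X ∧ F x ≤ 1} :=
    ((measurableSet_le hVc.abs.measurable hUc.measurable).inter
      (measurableSet_lt hUc.measurable (hVc.abs.measurable.const_mul _))).inter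
      (measurableSet_le hFc.measurable measurable_const)
  have hfront : volume (frontier {x | x ∈ X ∧ F x ≤ 1}) = 0 := by
    refine measure_mono_null (t := {x : Fin 2 → ℝ | (U x, V x) ∈
      {p : ℝ × ℝ | (|p.2| = p.1 ∨ p.1 = k ^ 2 * |p.2|) ∨ |p.1 * p.2| = s ^ 2}}) ?_ ?_
    · intro x hx
      rcases frontier_inter_subset X {x | F x ≤ 1} hx with ⟨h, -⟩ | ⟨-, h⟩
      · rcases frontier_inter_subset {x | |V x| ≤ U x} {x | U x < k ^ 2 * |V x|} h with
          ⟨h, -⟩ | ⟨-, h⟩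
        · exact Or.inl (Or.inl (frontier_le_subset_eq hVc.abs hUc h))
        · exact Or.inl (Or.inr (frontier_lt_subset_eq hUc (hVc.abs.const_mul _) h))
      · exact Or.inr ((hF1' x).1 (frontier_le_subset_eq hFc continuous_const h))
    · rw [volume_setOf_linear_mem hA' hδ0, volume_hyperbolic_sector_boundary hk, mul_zero]
  have hcov : ZLattice.covolume L = 1 := by
    rw [ZLattice.covolume_eq_measure_fundamentalDomain L volume
      (ZSpan.isAddFundamentalDomain (Pi.basisFun ℝ (Fin 2)) volume),
      ZSpan.volume_real_fundamentalDomain]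
    have : Matrix.of ⇑(Pi.basisFun ℝ (Fin 2)) = 1 := by
      ext i j
      simp [Matrix.one_apply, Pi.single_apply, eq_comm]
    rw [this]
    simp
  have hXsmul : ∀ ⦃x : Fin 2 → ℝ⦄ ⦃r : ℝ⦄, x ∈ X → 0 < r → r • x ∈ X := by
    rintro x r ⟨h1, h2⟩ hr
    have e1 : U (r • x) = r * U x := by simp [U]; ring
    have e2 : V (r • x) = r * V x := by simp [V]; ring
    refine ⟨?_, ?_⟩ <;> rw [e1, e2, abs_mul, abs_of_pos hr]
    · gcongr
    · rw [mul_left_comm]; gcongr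
  have hFsmul : ∀ (x : Fin 2 → ℝ) ⦃r : ℝ⦄, 0 ≤ r → F (r • x) = r ^ Fintype.card (Fin 2) * F x := by
    intro x r hr
    rw [Fintype.card_fin, ← abs_of_nonneg (pow_nonneg hr 2)]
    simp only [F]
    rw [← abs_mul]
    congr 1
    simp
    ring
  have main := ZLattice.covolume.tendsto_card_le_div L hXsmul hFsmul hbdd hmeas hfront
  rw [hvol, hcov, div_one] at main
  refine main.congr fun t => ?_
  congr 2
  rw [Nat.card_coe_set_eq]
  symm
  refine Set.ncard_congr (fun x _ => ![(x.1 : ℝ), (x.2 : ℝ)]) ?_ ?_ ?_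
  · rintro x ⟨⟨h1, h2⟩, h3⟩
    refine ⟨⟨⟨h1, h2⟩, ?_⟩, ?_⟩
    · simpa [F, Qval] using h3
    · refine (Module.Basis.mem_span_iff_repr_mem ℤ (Pi.basisFun ℝ (Fin 2)) _).2 fun i => ?_
      fin_cases i
      · exact ⟨x.1, by simp⟩
      · exact ⟨x.2, by simp⟩
  · intro x y _ _ h
    have h0 := congrFun h 0
    have h1 := congrFun h 1
    simp only [Matrix.cons_val_zero, Matrix.cons_val_one, Int.cast_inj] at h0 h1
    exact Prod.ext h0 h1
  · rintro y ⟨⟨⟨h1, h2⟩, h3⟩, h4⟩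
    have h4' := (Module.Basis.mem_span_iff_repr_mem ℤ (Pi.basisFun ℝ (Fin 2)) _).1 h4
    obtain ⟨a, ha⟩ := h4' 0
    obtain ⟨b, hb⟩ := h4' 1
    simp only [algebraMap_int_eq, eq_intCast, Pi.basisFun_repr] at ha hb
    obtain rfl : y = ![(a : ℝ), (b : ℝ)] := by
      ext i
      fin_cases i
      · exact ha.symm
      · exact hb.symm
    refine ⟨(a, b), ⟨⟨h1, h2⟩, ?_⟩, rfl⟩
    simpa [F, Qval] using h3

/-- Corollary 1.3 of the paper. Let `Q` be a primitive indefinite integral binary quadratic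
form of non-square discriminant `D = B² - 4AC`, let `(t_Q, u_Q)` be the fundamental solution
of the Pell equation `t² - D u² = 4` (`t_Q, u_Q > 0`, `u_Q` minimal), and
`R_Q = log ε_Q = log ((t_Q + u_Q √D)/2)`. Then `Ψ_Q(t) ∼ (12 R_Q / (π² √D)) · t` as
`t → +∞`. -/
theorem stmt13 (A B C : ℤ) (hprim : Int.gcd A (Int.gcd B C) = 1)
    (hindef : 0 < B ^ 2 - 4 * A * C) (hnsq : ¬ IsSquare (B ^ 2 - 4 * A * C))
    (tQ uQ : ℤ) (htQ : 0 < tQ) (huQ : 0 < uQ)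
    (hPell : tQ ^ 2 - (B ^ 2 - 4 * A * C) * uQ ^ 2 = 4)
    (hmin : ∀ t u : ℤ, 0 < t → 0 < u → t ^ 2 - (B ^ 2 - 4 * A * C) * u ^ 2 = 4 → uQ ≤ u) :
    Asymptotics.IsEquivalent Filter.atTop
      (fun t : ℝ => (Psi A B C t : ℝ))
      (fun t : ℝ =>
        12 * Real.log (((tQ : ℝ) + (uQ : ℝ) *
            Real.sqrt ((B ^ 2 - 4 * A * C : ℤ) : ℝ)) / 2) /
          (π ^ 2 * Real.sqrt ((B ^ 2 - 4 * A * C : ℤ) : ℝ)) * t) := by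
  set D : ℤ := B ^ 2 - 4 * A * C with hD
  set δ : ℝ := √(D : ℝ) with hδdef
  have hDpos : (0 : ℝ) < (D : ℝ) := by exact_mod_cast hindef
  have hδ0 : 0 < δ := Real.sqrt_pos.2 hDpos
  have hδ : δ ^ 2 = B ^ 2 - 4 * A * C := by
    rw [hδdef, Real.sq_sqrt hDpos.le, hD]
    push_cast
    ring
  have hk : 1 < ((tQ : ℝ) + uQ * δ) / 2 := by
    have ht2 : 2 ≤ tQ := by nlinarith [mul_pos hindef (pow_pos huQ 2)]
    have ht2' : (2 : ℝ) ≤ tQ := by exact_mod_cast ht2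
    have hu' : (0 : ℝ) < uQ := by exact_mod_cast huQ
    have := mul_pos hu' hδ0
    linarith
  set k : ℝ := ((tQ : ℝ) + uQ * δ) / 2 with hkdef
  have hlog := Real.log_pos hk
  have hscale : ∀ (δ' : ℝ) (x : ℤ × ℤ) (d : ℕ),
      linForm A B δ' ((d : ℤ) • x) = d * linForm A B δ' x := by
    intro δ' x d
    simp [linForm]
    ring
  have h0 : (0 : ℤ × ℤ) ∉ sectorSet A B δ k := fun h => by
    simpa [linForm] using linForm_pos_of_mem_sectorSet h
  have hlim := tendsto_ncard_isCoprime_div (X := sectorSet A B δ k)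
    (f := fun x => ((|Qval A B C x| : ℤ) : ℝ)) (c := 2 * Real.log k / δ) (fun x d hd => by
      have hd' : (0 : ℝ) < d := by exact_mod_cast hd
      simp only [sectorSet, Set.mem_ofPred_eq, hscale, abs_mul, abs_of_pos hd']
      rw [mul_left_comm, mul_le_mul_iff_right₀ hd', mul_lt_mul_iff_right₀ hd'])
    (fun x d => by
      have : Qval A B C ((d : ℤ) • x) = (d : ℤ) ^ 2 * Qval A B C x := by
        simp [Qval]
        ring
      rw [this, abs_mul, abs_of_nonneg (by positivity : (0 : ℤ) ≤ (d : ℤ) ^ 2)]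
      push_cast
      ring)
    (fun x hx => by
      have := Int.one_le_abs (Qval_ne_zero hnsq (fun h : x = 0 => h0 (h ▸ hx)))
      exact_mod_cast this)
    h0 (by positivity)
    (tendsto_ncard_sectorSet_div (leadingCoeff_ne_zero hnsq) hδ hδ0 hk)
  have hc : 12 * Real.log k / (π ^ 2 * δ) ≠ 0 := by positivity
  refine Asymptotics.isEquivalent_of_tendsto_one ?_
  have hone := hlim.div_const (12 * Real.log k / (π ^ 2 * δ))
  rw [show 6 / π ^ 2 * (2 * Real.log k / δ) = 12 * Real.log k / (π ^ 2 * δ) by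
    field_simp
    ring, div_self hc] at hone
  refine hone.congr fun t => ?_
  simp only [Pi.div_apply]
  rw [Psi_eq_ncard hprim hnsq hδ hδ0 htQ huQ hPell hmin hk, div_div, mul_comm t]
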